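/- arXiv:1207.0648 — 5 statements merged into one kernel-verified Lean document; each statement's English description precedes it below -/
import Mathlib

section
/- Let M be a compact topological space and μ a finite Borel measure on M with full support. Let ũ, ṽ : M → ℝ be continuous functions that are orthonormal in L²(μ), i.e. ∫ ũ² dμ = ∫ ṽ² dμ = 1 and ∫ ũ·ṽ dμ = 0. Then there exist real numbers a, b, c, d such that the linear combinations u = a·ũ + b·ṽ and v = c·ũ + d·ṽ satisfy ∫ u² dμ = ∫ v² dμ = 1 and there exists a point x ∈ M with |u(x)| ≠ |v(x)|. -/
open MeasureTheory

theorem stmt_0 {M : Type*} [TopologicalSpace M] [CompactSpace M]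
    [MeasurableSpace M] [BorelSpace M]
    (μ : Measure M) [IsFiniteMeasure μ]
    (hfull : ∀ U : Set M, IsOpen U → U.Nonempty → 0 < μ U)
    (ut vt : M → ℝ) (hut : Continuous ut) (hvt : Continuous vt)
    (hu1 : ∫ x, ut x ^ 2 ∂μ = 1) (hv1 : ∫ x, vt x ^ 2 ∂μ = 1)
    (huv : ∫ x, ut x * vt x ∂μ = 0) :
    ∃ a b c d : ℝ,
      (∫ x, (a * ut x + b * vt x) ^ 2 ∂μ = 1) ∧
      (∫ x, (c * ut x + d * vt x) ^ 2 ∂μ = 1) ∧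
      ∃ x : M, |a * ut x + b * vt x| ≠ |c * ut x + d * vt x| := by
  by_contra! h
  have integrable {f : M → ℝ} (hf : Continuous f) : Integrable f μ :=
    hf.integrable_of_hasCompactSupport (HasCompactSupport.of_compactSpace f)
  have hrot : ∫ x, (3 / 5 * ut x + 4 / 5 * vt x) ^ 2 ∂μ = 1 := by
    have expand : ∀ x, (3 / 5 * ut x + 4 / 5 * vt x) ^ 2 =
        9 / 25 * ut x ^ 2 + 16 / 25 * vt x ^ 2 + 24 / 25 * (ut x * vt x) := fun x => by ring
    simp_rw [expand]
    rw [integral_add (integrable (by fun_prop)) (integrable (by fun_prop)),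
      integral_add (integrable (by fun_prop)) (integrable (by fun_prop)),
      integral_const_mul, integral_const_mul, integral_const_mul, hu1, hv1, huv]
    norm_num
  have hzero : ∀ x, ut x ^ 2 = 0 := fun x => by
    have hsq : ut x ^ 2 = vt x ^ 2 := by
      simpa using sq_eq_sq_iff_abs_eq_abs _ _ |>.2 (h 1 0 0 1 (by simpa) (by simpa) x)
    have hsq_rot : ut x ^ 2 = (3 / 5 * ut x + 4 / 5 * vt x) ^ 2 := by
      simpa using sq_eq_sq_iff_abs_eq_abs _ _ |>.2
        (h 1 0 (3 / 5) (4 / 5) (by simpa) hrot x)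
    have hmul : ut x * vt x = 0 := by linarith
    have hfour : (ut x ^ 2) ^ 2 = 0 := by
      calc (ut x ^ 2) ^ 2 = ut x ^ 2 * vt x ^ 2 := by rw [← hsq]; ring
        _ = (ut x * vt x) ^ 2 := by ring
        _ = 0 := by rw [hmul]; norm_num
    exact pow_eq_zero_iff two_ne_zero |>.1 hfour
  simp [hzero] at hu1
end

section
/- Let M be a nonempty topological space which is a Baire space, let E be a real inner product space of finite dimension r, let ℓ be a natural number with ℓ > r, and let u₁, …, u_ℓ : M → E be continuous maps such that ⟪u_i(x), u_j(x)⟫ = 0 for all i ≠ j and all x ∈ M. Then there exist an index i and a nonempty open set U ⊆ M such that u_i(x) = 0 for all x ∈ U. -/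
open RealInnerProductSpace

theorem stmt_2 {M : Type*} [TopologicalSpace M] [Nonempty M] [BaireSpace M]
    {E : Type*} [NormedAddCommGroup E] [InnerProductSpace ℝ E] [FiniteDimensional ℝ E]
    (ℓ : ℕ) (hℓ : ℓ > Module.finrank ℝ E)
    (u : Fin ℓ → M → E) (hcont : ∀ i, Continuous (u i))
    (horth : ∀ i j, i ≠ j → ∀ x : M, ⟪u i x, u j x⟫ = 0) :
    ∃ (i : Fin ℓ) (U : Set M), IsOpen U ∧ U.Nonempty ∧ ∀ x ∈ U, u i x = 0 := by
  have hcover : ⋃ i, {x | u i x = 0} = Set.univ := by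
    refine Set.eq_univ_of_forall fun x => ?_
    by_contra hx
    simp only [Set.mem_iUnion, Set.mem_ofPred_eq, not_exists] at hx
    have hli : LinearIndependent ℝ fun i => u i x :=
      linearIndependent_of_ne_zero_of_inner_eq_zero hx fun i j hij => horth i j hij x
    have hcard := hli.fintype_card_le_finrank
    rw [Fintype.card_fin] at hcard
    exact hℓ.not_ge hcard
  obtain ⟨i, hi⟩ := nonempty_interior_of_iUnion_of_closed
    (fun i => isClosed_eq (hcont i) continuous_const) hcover
  exact ⟨i, _, isOpen_interior, hi, fun x hx => (interior_subset hx : x ∈ {y | u i y = 0})⟩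
end

section
/- Let H be a real inner product space, and let B : ℝ → (H →L H) be a map into continuous linear operators such that each B(ε) is symmetric. Suppose u, v : ℝ → H and λ, μ : ℝ → ℝ satisfy B(ε)(u(ε)) = λ(ε)·u(ε), B(ε)(v(ε)) = μ(ε)·v(ε), ‖u(ε)‖ = ‖v(ε)‖ = 1, and ⟪u(ε), v(ε)⟫ = 0 for all ε; assume B, u, v, λ, μ are differentiable at 0 (B with respect to the operator norm) and λ(0) = μ(0). Then ⟪B'(0)(u(0)), v(0)⟫ = 0. -/
open RealInnerProductSpace

theorem stmt_6 {H : Type*} [NormedAddCommGroup H] [InnerProductSpace ℝ H]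
    (B : ℝ → H →L[ℝ] H)
    (hsymm : ∀ (ε : ℝ) (u w : H), ⟪B ε u, w⟫ = ⟪u, B ε w⟫)
    (u v : ℝ → H) (lam mu : ℝ → ℝ)
    (hequ : ∀ ε : ℝ, B ε (u ε) = lam ε • u ε)
    (heqv : ∀ ε : ℝ, B ε (v ε) = mu ε • v ε)
    (hnu : ∀ ε : ℝ, ‖u ε‖ = 1) (hnv : ∀ ε : ℝ, ‖v ε‖ = 1)
    (horth : ∀ ε : ℝ, ⟪u ε, v ε⟫ = 0)
    (hB : DifferentiableAt ℝ B 0) (hu : DifferentiableAt ℝ u 0)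
    (hv : DifferentiableAt ℝ v 0)
    (hlam : DifferentiableAt ℝ lam 0) (hmu : DifferentiableAt ℝ mu 0)
    (h0 : lam 0 = mu 0) :
    ⟪deriv B 0 (u 0), v 0⟫ = 0 := by
  have hderiv : deriv B 0 (u 0) + B 0 (deriv u 0) = lam 0 • deriv u 0 + deriv lam 0 • u 0 := by
    have h₁ := hB.hasDerivAt.clm_apply hu.hasDerivAt
    have h₂ := hlam.hasDerivAt.fun_smul hu.hasDerivAt
    simp only [hequ] at h₁
    exact h₁.unique h₂
  have hinner := congrArg (fun x => ⟪x, v 0⟫) hderiv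
  simp only [inner_add_left, real_inner_smul_left, horth, hsymm 0 (deriv u 0), heqv,
    real_inner_smul_right, h0] at hinner
  linarith
end

section
/- Let H be a real inner product space, let T : H →L H be a symmetric continuous linear operator (⟪T u, w⟫ = ⟪u, T w⟫ for all u, w), let η ∈ ℝ, and let B : ℝ → (H →L H) be a differentiable family (with respect to the operator norm) of symmetric continuous linear operators such that B'(ε) = η·(T ∘ B(ε) + B(ε) ∘ T) for all ε. Suppose u : ℝ → H and λ : ℝ → ℝ are differentiable with ‖u(ε)‖ = 1 and B(ε)(u(ε)) = λ(ε)·u(ε) for all ε. Then λ'(ε) = 2η·λ(ε)·⟪T(u(ε)), u(ε)⟫, and consequently |λ'(ε)| ≤ 2·|η|·‖T‖·|λ(ε)| for all ε. -/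
open RealInnerProductSpace

/-- **Hellmann-Feynman formula**: the derivative of an eigenvalue along a differentiable family of
symmetric operators with normalised eigenvectors. -/
theorem hasDerivAt_eigenvalue_eq_inner {H : Type*} [NormedAddCommGroup H] [InnerProductSpace ℝ H]
    {B : ℝ → H →L[ℝ] H} {B' : H →L[ℝ] H} {u : ℝ → H} {u' : H} {lam : ℝ → ℝ} {lam' ε : ℝ}
    (hB : HasDerivAt B B' ε) (hu : HasDerivAt u u' ε) (hlam : HasDerivAt lam lam' ε)
    (hsymm : ∀ v w : H, ⟪B ε v, w⟫ = ⟪v, B ε w⟫) (hnorm : ‖u ε‖ = 1)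
    (heig : ∀ t : ℝ, B t (u t) = lam t • u t) :
    lam' = ⟪B' (u ε), u ε⟫ := by
  have h₁ := hB.clm_apply hu
  simp only [heig] at h₁
  have h₂ := congrArg (fun v => ⟪v, u ε⟫) (h₁.unique (hlam.smul hu))
  simp only [inner_add_left, real_inner_smul_left, hsymm, heig, real_inner_smul_right,
    real_inner_self_eq_norm_sq, hnorm] at h₂
  linarith

theorem stmt_10 {H : Type*} [NormedAddCommGroup H] [InnerProductSpace ℝ H]
    (T : H →L[ℝ] H) (hT : ∀ u w : H, ⟪T u, w⟫ = ⟪u, T w⟫)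
    (η : ℝ) (B : ℝ → H →L[ℝ] H) (hBdiff : Differentiable ℝ B)
    (hBsymm : ∀ (ε : ℝ) (u w : H), ⟪B ε u, w⟫ = ⟪u, B ε w⟫)
    (hB' : ∀ ε : ℝ, deriv B ε = η • (T ∘L B ε + B ε ∘L T))
    (u : ℝ → H) (lam : ℝ → ℝ)
    (hu : Differentiable ℝ u) (hlam : Differentiable ℝ lam)
    (hnorm : ∀ ε : ℝ, ‖u ε‖ = 1)
    (heig : ∀ ε : ℝ, B ε (u ε) = lam ε • u ε) :
    ∀ ε : ℝ, deriv lam ε = 2 * η * lam ε * ⟪T (u ε), u ε⟫ ∧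
      |deriv lam ε| ≤ 2 * |η| * ‖T‖ * |lam ε| := by
  intro ε
  have hderiv : deriv lam ε = 2 * η * lam ε * ⟪T (u ε), u ε⟫ := by
    rw [hasDerivAt_eigenvalue_eq_inner (hBdiff ε).hasDerivAt (hu ε).hasDerivAt
      (hlam ε).hasDerivAt (hBsymm ε) (hnorm ε) heig, hB' ε]
    simp only [smul_apply, add_apply,
      ContinuousLinearMap.comp_apply, heig, map_smul, real_inner_smul_left, inner_add_left,
      hBsymm, real_inner_smul_right]
    ring
  have hbound : |⟪T (u ε), u ε⟫| ≤ ‖T‖ := by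
    have h := (abs_real_inner_le_norm (T (u ε)) (u ε)).trans
      (mul_le_mul_of_nonneg_right (T.le_opNorm (u ε)) (norm_nonneg (u ε)))
    simpa only [hnorm, mul_one] using h
  refine ⟨hderiv, ?_⟩
  calc |deriv lam ε| = 2 * |η| * |lam ε| * |⟪T (u ε), u ε⟫| := by
        rw [hderiv, abs_mul, abs_mul, abs_mul, abs_two]
    _ ≤ 2 * |η| * |lam ε| * ‖T‖ := by gcongr
    _ = 2 * |η| * ‖T‖ * |lam ε| := by ring
end

section
/- Let H be a complex Hilbert space, ι an index type, (e_i)_{i∈ι} a Hilbert basis of H, and T : H → H a (not necessarily continuous) ℂ-linear map such that T(e_i) = λ_i·e_i where each λ_i is a real number. Then for every z ∈ ℂ with nonzero imaginary part, the range of the map u ↦ T u − z·u is dense in H. -/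
theorem stmt_13 {H : Type*} [NormedAddCommGroup H] [InnerProductSpace ℂ H]
    [CompleteSpace H] {ι : Type*} (b : HilbertBasis ι ℂ H)
    (T : H →ₗ[ℂ] H) (lam : ι → ℝ)
    (heig : ∀ i : ι, T (b i) = (lam i : ℂ) • b i) :
    ∀ z : ℂ, z.im ≠ 0 → Dense (Set.range fun u : H => T u - z • u) := by
  intro z hz
  have hspan : Submodule.span ℂ (Set.range b) ≤ LinearMap.range (T - z • LinearMap.id) := by
    rw [Submodule.span_le]
    rintro _ ⟨i, rfl⟩
    have hne : (lam i : ℂ) - z ≠ 0 := fun h => hz (by simpa using congrArg Complex.im h)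
    refine ⟨((lam i : ℂ) - z)⁻¹ • b i, ?_⟩
    simp only [map_smul, LinearMap.sub_apply, LinearMap.smul_apply, LinearMap.id_apply, heig,
      ← sub_smul]
    exact inv_smul_smul₀ hne (b i)
  exact (Submodule.dense_iff_topologicalClosure_eq_top.mpr b.dense_span).mono hspan
end
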